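/- In the setting of an L-layer ReLU multilayer perceptron with layers f_l(x) = A_lᵀx + b_l and activation r(x) = max(0, x), let Y_{l−1} and X̃_{l−1} be random vectors with laws ρ_{Y_{l−1}} and ρ_{X̃_{l−1}} of finite first moment, let Y_l = r(f_l(Y_{l−1})), and let X̃_l be a Gaussian vector with independent coordinates whose coordinatewise means μ̃_{l,i} and variances σ̃²_{l,i} match those of r(f_l(X̃_{l−1}))). Then W₁(ρ_{Y_l}, ρ_{X̃_l}) ≤ G(X̃_l) + ‖A_l‖ · W₁(ρ_{Y_{l−1}}, ρ_{X̃_{l−1}}) + C_l, where G(X̃_l) = ∑_i [σ̃_{l,i}·φ(μ̃_{l,i}/σ̃_{l,i}) − μ̃_{l,i}·Φ(−μ̃_{l,i}/σ̃_{l,i})] and C_l = W₁(law of f_l(X̃_{l−1}), law of X̃_l). -/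

import Mathlib

open MeasureTheory ProbabilityTheory Real Matrix

/-- The probability density function `φ` of the standard normal distribution. -/
noncomputable def stdGaussianPDF (x : ℝ) : ℝ :=
  (Real.sqrt (2 * Real.pi))⁻¹ * Real.exp (-(x ^ 2) / 2)

/-- The cumulative distribution function `Φ` of the standard normal distribution. -/
noncomputable def stdGaussianCDF (x : ℝ) : ℝ :=
  cdf (gaussianReal 0 1) x

/-- The 1-Wasserstein distance between two measures with respect to a cost/distance
function `dst`: the infimum over all couplings `γ` (measures on the product space whose
marginals are `ρ₁` and `ρ₂`) of `∫ dst(x, y) dγ(x, y)`. -/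
noncomputable def W1 {α : Type*} [MeasurableSpace α] (dst : α → α → ℝ)
    (ρ₁ ρ₂ : Measure α) : ℝ :=
  sInf { c | ∃ γ : Measure (α × α),
    γ.map Prod.fst = ρ₁ ∧ γ.map Prod.snd = ρ₂ ∧ c = ∫ p, dst p.1 p.2 ∂γ }

/-- The ℓ1 distance on `ℝ^n`. -/
noncomputable def l1dist {n : ℕ} (x y : Fin n → ℝ) : ℝ := ∑ i, |x i - y i|

/-- The operator norm of a matrix `A`, viewed as a linear map between ℓ1 spaces:
the least nonnegative constant `c` with `‖A v‖₁ ≤ c · ‖v‖₁` for all `v`. -/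
noncomputable def l1OpNorm {m n : ℕ} (A : Matrix (Fin m) (Fin n) ℝ) : ℝ :=
  sInf { c | 0 ≤ c ∧ ∀ v : Fin n → ℝ, ∑ i, |A.mulVec v i| ≤ c * ∑ j, |v j| }

/-- Gluing: a measure on `β × Ω` whose first marginal is a pushforward `γ.map g` lifts to a measure
on `α × Ω` with first marginal `γ`. -/
lemma exists_glue {α β Ω : Type*} [MeasurableSpace α] [MeasurableSpace β] [MeasurableSpace Ω]
    [StandardBorelSpace Ω] [Nonempty Ω] (γ : Measure α) [IsProbabilityMeasure γ]
    (η : Measure (β × Ω)) [IsFiniteMeasure η] {g : α → β} (hg : Measurable g)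
    (h : η.map Prod.fst = γ.map g) :
    ∃ Γ : Measure (α × Ω), Γ.map Prod.fst = γ ∧ Γ.map (Prod.map g id) = η := by
  refine ⟨γ ⊗ₘ (η.condKernel.comap g hg), Measure.fst_compProd γ _, ?_⟩
  have hη : (γ.map g) ⊗ₘ η.condKernel = η := by
    rw [← h]
    exact η.disintegrate η.condKernel
  have hm : Measurable (Prod.map g (id : Ω → Ω)) := hg.prodMap measurable_id
  have : IsProbabilityMeasure (γ.map g) := Measure.isProbabilityMeasure_map hg.aemeasurable
  conv_rhs => rw [← hη]
  ext s hs
  rw [Measure.map_apply hm hs, Measure.compProd_apply (hm hs), Measure.compProd_apply hs,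
    lintegral_map (Kernel.measurable_kernel_prodMk_left hs) hg]
  rfl

lemma isProbabilityMeasure_of_map_eq {α β : Type*} [MeasurableSpace α] [MeasurableSpace β]
    {γ : Measure α} {ρ : Measure β} [IsProbabilityMeasure ρ] {g : α → β} (hg : Measurable g)
    (h : γ.map g = ρ) : IsProbabilityMeasure γ := by
  constructor
  have := measure_univ (μ := ρ)
  rwa [← h, Measure.map_apply hg MeasurableSet.univ, Set.preimage_univ] at this

lemma W1_le_integral {α : Type*} [MeasurableSpace α] {dst : α → α → ℝ}
    (hd : ∀ x y, 0 ≤ dst x y) {ρ₁ ρ₂ : Measure α} {γ : Measure (α × α)}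
    (h₁ : γ.map Prod.fst = ρ₁) (h₂ : γ.map Prod.snd = ρ₂) :
    W1 dst ρ₁ ρ₂ ≤ ∫ p, dst p.1 p.2 ∂γ := by
  refine csInf_le ⟨0, ?_⟩ ⟨γ, h₁, h₂, rfl⟩
  rintro c ⟨γ', -, -, rfl⟩
  exact integral_nonneg fun p => hd _ _

lemma le_add_mul_W1 {α : Type*} [MeasurableSpace α] {dst : α → α → ℝ} {ρ₁ ρ₂ : Measure α}
    [IsProbabilityMeasure ρ₁] [IsProbabilityMeasure ρ₂] {w a k : ℝ} (hk : 0 ≤ k)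
    (h : ∀ γ : Measure (α × α), γ.map Prod.fst = ρ₁ → γ.map Prod.snd = ρ₂ →
      w ≤ a + k * ∫ p, dst p.1 p.2 ∂γ) :
    w ≤ a + k * W1 dst ρ₁ ρ₂ := by
  rw [W1, ← smul_eq_mul k, ← Real.sInf_smul_of_nonneg hk, ← sub_le_iff_le_add']
  refine le_csInf ?_ ?_
  · refine Set.Nonempty.smul_set ⟨_, ρ₁.prod ρ₂, ?_, ?_, rfl⟩
    · exact Measure.fst_prod
    · exact Measure.snd_prod
  · rintro _ ⟨c, ⟨γ, h₁, h₂, rfl⟩, rfl⟩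
    rw [sub_le_iff_le_add']
    exact h γ h₁ h₂

lemma l1OpNorm_nonneg {m n : ℕ} (A : Matrix (Fin m) (Fin n) ℝ) : 0 ≤ l1OpNorm A :=
  Real.sInf_nonneg fun _ hc => hc.1

lemma sum_abs_mulVec_le {m n : ℕ} (A : Matrix (Fin m) (Fin n) ℝ) (v : Fin n → ℝ) :
    ∑ i, |A.mulVec v i| ≤ l1OpNorm A * ∑ j, |v j| := by
  rw [l1OpNorm, mul_comm, ← smul_eq_mul, ← Real.sInf_smul_of_nonneg (by positivity)]
  refine le_csInf (Set.Nonempty.smul_set ⟨∑ i, ∑ j, |A i j|, by positivity, fun w => ?_⟩) ?_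
  · rw [Finset.sum_mul]
    refine Finset.sum_le_sum fun i _ => ?_
    rw [Matrix.mulVec, dotProduct]
    refine (Finset.abs_sum_le_sum_abs _ _).trans ?_
    rw [Finset.sum_mul]
    refine Finset.sum_le_sum fun j _ => ?_
    rw [abs_mul]
    gcongr
    exact Finset.single_le_sum (f := fun j => |w j|) (fun _ _ => abs_nonneg _) (Finset.mem_univ j)
  · rintro _ ⟨c, hc, rfl⟩
    simpa [mul_comm] using hc.2 v

lemma l1dist_nonneg {n : ℕ} (x y : Fin n → ℝ) : 0 ≤ l1dist x y :=
  Finset.sum_nonneg fun _ _ => abs_nonneg _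

lemma l1dist_affine_le {m n : ℕ} (A : Matrix (Fin m) (Fin n) ℝ) (b : Fin m → ℝ)
    (x y : Fin n → ℝ) :
    l1dist (A.mulVec x + b) (A.mulVec y + b) ≤ l1OpNorm A * l1dist x y := by
  convert sum_abs_mulVec_le A (x - y) using 1
  · simp [l1dist, Matrix.mulVec_sub]
  · simp [l1dist]

lemma abs_relu_sub_le (a c z : ℝ) :
    |max 0 a - z| ≤ max 0 (-z) + |a - c| + |c - z| := by
  have h₁ : |max 0 a - max 0 z| ≤ |a - z| := by
    simpa using abs_max_sub_max_le_max 0 a 0 z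
  have h₂ : |max 0 z - z| = max 0 (-z) := by
    rcases le_total 0 z with h | h <;> simp [h]
  linarith [abs_sub_le (max 0 a) (max 0 z) z, abs_sub_le a c z]

lemma integrable_l1dist_of_map {m : ℕ} {ρ₁ ρ₂ : Measure (Fin m → ℝ)}
    {γ : Measure ((Fin m → ℝ) × (Fin m → ℝ))}
    (h₁ : γ.map Prod.fst = ρ₁) (h₂ : γ.map Prod.snd = ρ₂)
    (hρ₁ : ∀ i, Integrable (fun x => x i) ρ₁) (hρ₂ : ∀ i, Integrable (fun x => x i) ρ₂) :
    Integrable (fun p => l1dist p.1 p.2) γ := by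
  subst h₁ h₂
  exact integrable_finsetSum _ fun i _ =>
    (((hρ₁ i).comp_measurable measurable_fst).sub ((hρ₂ i).comp_measurable measurable_snd)).abs

lemma integrable_coord {m : ℕ} {ρ : Measure (Fin m → ℝ)}
    (h : Integrable (fun x => ∑ i, |x i|) ρ) (i : Fin m) : Integrable (fun x => x i) ρ := by
  refine h.mono' (measurable_pi_apply i).aestronglyMeasurable (.of_forall fun x => ?_)
  exact Finset.single_le_sum (f := fun i => |x i|) (fun _ _ => abs_nonneg _) (Finset.mem_univ i)

lemma hasDerivAt_neg_stdGaussianPDF (x : ℝ) :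
    HasDerivAt (fun t => -stdGaussianPDF t) (x * stdGaussianPDF x) x := by
  unfold stdGaussianPDF
  have h : HasDerivAt (fun t : ℝ => -(t ^ 2) / 2) (-x) x := by
    refine ((hasDerivAt_pow 2 x).neg.div_const 2).congr_deriv ?_
    push_cast
    ring
  refine (h.exp.const_mul (√(2 * π))⁻¹).neg.congr_deriv ?_
  ring

lemma stdGaussianPDF_eq (x : ℝ) : stdGaussianPDF x = gaussianPDFReal 0 1 x := by
  simp [stdGaussianPDF, gaussianPDFReal]

lemma tendsto_neg_stdGaussianPDF_atBot :
    Filter.Tendsto (fun t => -stdGaussianPDF t) Filter.atBot (nhds 0) := by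
  unfold stdGaussianPDF
  have h : Filter.Tendsto (fun t : ℝ => -(t ^ 2) / 2) Filter.atBot Filter.atBot := by
    have : Filter.Tendsto (fun t : ℝ => t ^ 2) Filter.atBot Filter.atTop :=
      Filter.tendsto_pow_atTop (α := ℝ) two_ne_zero |>.comp Filter.tendsto_abs_atBot_atTop
        |>.congr fun t => by simp
    exact (Filter.tendsto_neg_atTop_atBot.comp this).atBot_div_const two_pos
  simpa using ((Real.tendsto_exp_atBot.comp h).const_mul (√(2 * π))⁻¹).neg

lemma integrable_id_gaussianReal (μ : ℝ) (v : NNReal) :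
    Integrable (fun x : ℝ => x) (gaussianReal μ v) :=
  (memLp_id_gaussianReal 1).integrable le_rfl

lemma setIntegral_Iic_id_gaussianReal (a : ℝ) :
    ∫ x in Set.Iic a, x ∂(gaussianReal 0 1) = -stdGaussianPDF a := by
  have hint : Integrable (fun x => x * stdGaussianPDF x) volume := by
    have h := integrable_id_gaussianReal 0 1
    rw [gaussianReal_of_var_ne_zero 0 one_ne_zero,
      integrable_withDensity_iff (measurable_gaussianPDF 0 1)
        (.of_forall fun _ => gaussianPDF_lt_top)] at h
    simpa [stdGaussianPDF_eq, toReal_gaussianPDF] using h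
  have h := integral_Iic_of_hasDerivAt_of_tendsto' (a := a)
    (fun x _ => hasDerivAt_neg_stdGaussianPDF x) hint.integrableOn
    tendsto_neg_stdGaussianPDF_atBot
  rw [sub_zero] at h
  rw [← h, ← integral_indicator measurableSet_Iic, ← integral_indicator measurableSet_Iic,
    integral_gaussianReal_eq_integral_smul one_ne_zero]
  congr 1 with x
  by_cases hx : x ∈ Set.Iic a <;> simp [hx, stdGaussianPDF_eq, mul_comm]

lemma integral_max_zero_neg_gaussianReal (μ : ℝ) {σ : ℝ} (hσ : 0 < σ) :
    ∫ z, max 0 (-z) ∂(gaussianReal μ (NNReal.mk (σ ^ 2) (sq_nonneg _))) =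
      σ * stdGaussianPDF (μ / σ) - μ * stdGaussianCDF (-(μ / σ)) := by
  have hmap : gaussianReal μ (NNReal.mk (σ ^ 2) (sq_nonneg _)) =
      (gaussianReal 0 1).map (fun x => σ * x + μ) := by
    have h := gaussianReal_map_const_mul (μ := 0) (v := 1) σ
    have h' := gaussianReal_map_add_const (μ := σ * 0) (v := (NNReal.mk (σ ^ 2) (sq_nonneg _)) * 1) μ
    rw [← h, Measure.map_map (by fun_prop) (by fun_prop)] at h'
    simpa [Function.comp_def] using h'.symm
  have hind : ∀ x, max 0 (-(σ * x + μ)) =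
      (Set.Iic (-(μ / σ))).indicator (fun x => -σ * x - μ) x := by
    intro x
    have key : x ≤ -(μ / σ) ↔ σ * x + μ ≤ 0 := by
      rw [← neg_div, le_div_iff₀ hσ]
      constructor <;> intro h <;> linarith
    by_cases hx : x ≤ -(μ / σ)
    · rw [Set.indicator_of_mem (Set.mem_Iic.2 hx), max_eq_right (by linarith [key.1 hx])]
      ring
    · rw [Set.indicator_of_notMem (by simpa using hx),
        max_eq_left (by linarith [not_le.1 fun h => hx (key.2 h)])]
  rw [hmap, integral_map (by fun_prop) (by fun_prop)]
  simp_rw [hind]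
  rw [integral_indicator measurableSet_Iic, integral_sub
    ((integrable_id_gaussianReal 0 1).const_mul _).integrableOn (integrable_const _),
    integral_const_mul, setIntegral_Iic_id_gaussianReal, stdGaussianCDF, cdf_eq_real]
  simp [stdGaussianPDF, mul_comm]

/-- One-layer recursion of the moment matching error in a ReLU MLP.
For a layer `f(x) = Aᵀ x + b` with ReLU activation, laws `ρ_Y` of `Y_{l−1}` and `ρ_X̃` of
`X̃_{l−1}` with finite first moments, and `X̃_l` a Gaussian vector with independent
coordinates matching the coordinatewise means `μ̃` and variances `σ̃²` of `r(f(X̃_{l−1}))`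
(with law `νl`),
`W₁(ρ_{Y_l}, ρ_{X̃_l}) ≤ G(X̃_l) + ‖A‖·W₁(ρ_{Y_{l−1}}, ρ_{X̃_{l−1}}) + C_l`
where `G(X̃_l) = ∑ᵢ (σ̃ᵢ·φ(μ̃ᵢ/σ̃ᵢ) − μ̃ᵢ·Φ(−μ̃ᵢ/σ̃ᵢ))` and
`C_l = W₁(law of f(X̃_{l−1}), law of X̃_l)`. -/
theorem relu_layer_moment_matching_recursion {dIn dOut : ℕ}
    (A : Matrix (Fin dIn) (Fin dOut) ℝ) (b : Fin dOut → ℝ)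
    (ρY ρXt : Measure (Fin dIn → ℝ))
    [IsProbabilityMeasure ρY] [IsProbabilityMeasure ρXt]
    (hY : Integrable (fun x => ∑ i, |x i|) ρY)
    (hXt : Integrable (fun x => ∑ i, |x i|) ρXt)
    (μt σt : Fin dOut → ℝ) (hσt : ∀ i, 0 < σt i)
    (hμmatch : ∀ i, μt i = ∫ x, max 0 ((Aᵀ.mulVec x + b) i) ∂ρXt)
    (hσmatch : ∀ i, (σt i) ^ 2 = variance (fun x => max 0 ((Aᵀ.mulVec x + b) i)) ρXt)
    (νl : Measure (Fin dOut → ℝ))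
    (hνl : νl = Measure.pi (fun i => gaussianReal (μt i) ⟨(σt i) ^ 2, sq_nonneg _⟩)) :
    W1 l1dist (ρY.map (fun x i => max 0 ((Aᵀ.mulVec x + b) i))) νl ≤
      (∑ i, (σt i * stdGaussianPDF (μt i / σt i)
          - μt i * stdGaussianCDF (-(μt i / σt i))))
        + l1OpNorm Aᵀ * W1 l1dist ρY ρXt
        + W1 l1dist (ρXt.map (fun x => Aᵀ.mulVec x + b)) νl := by
  set g : (Fin dIn → ℝ) → Fin dOut → ℝ := fun x => Aᵀ.mulVec x + b with hg_def
  have hg : Measurable g := by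
    refine measurable_pi_lambda _ fun i => ?_
    simp only [hg_def, Pi.add_apply, Matrix.mulVec, dotProduct]
    fun_prop
  replace hνl : νl =
      Measure.pi (fun i => gaussianReal (μt i) (NNReal.mk (σt i ^ 2) (sq_nonneg _))) := hνl
  have hνprob : IsProbabilityMeasure νl := by rw [hνl]; infer_instance
  have hgprob : IsProbabilityMeasure (ρXt.map g) :=
    Measure.isProbabilityMeasure_map hg.aemeasurable
  have heval : ∀ i, νl.map (fun z => z i) = gaussianReal (μt i) (NNReal.mk (σt i ^ 2) (sq_nonneg _)) := by
    intro i
    rw [hνl]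
    exact (measurePreserving_eval _ i).map_eq
  have hν : ∀ i, Integrable (fun z => z i) νl := fun i => by
    have h := integrable_id_gaussianReal (μt i) (NNReal.mk (σt i ^ 2) (sq_nonneg _))
    rw [← heval i] at h
    exact h.comp_measurable (measurable_pi_apply i)
  have hgX : ∀ i, Integrable (fun y => y i) (ρXt.map g) := fun i => by
    rw [integrable_map_measure (measurable_pi_apply i).aestronglyMeasurable hg.aemeasurable]
    simp only [Function.comp_def, hg_def, Pi.add_apply, Matrix.mulVec, dotProduct]
    exact (integrable_finsetSum _ fun j _ => (integrable_coord hXt j).const_mul _).add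
      (integrable_const _)
  have hgap : ∀ i, ∫ z, max 0 (-z i) ∂νl =
      σt i * stdGaussianPDF (μt i / σt i) - μt i * stdGaussianCDF (-(μt i / σt i)) := by
    intro i
    rw [← integral_max_zero_neg_gaussianReal (μt i) (hσt i), ← heval i,
      integral_map (measurable_pi_apply i).aemeasurable (by fun_prop)]
  have hneg : ∀ i, Integrable (fun z => max 0 (-z i)) νl := fun i =>
    (integrable_const 0).sup (hν i).neg
  rw [← one_mul (W1 l1dist (ρXt.map g) νl)]
  refine le_add_mul_W1 zero_le_one fun η hη₁ hη₂ => ?_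
  rw [one_mul, add_right_comm]
  refine le_add_mul_W1 (l1OpNorm_nonneg _) fun γ hγ₁ hγ₂ => ?_
  have : IsProbabilityMeasure γ := isProbabilityMeasure_of_map_eq measurable_fst hγ₁
  have : IsProbabilityMeasure η := isProbabilityMeasure_of_map_eq measurable_fst hη₁
  have hg₂ : Measurable fun p : (Fin dIn → ℝ) × (Fin dIn → ℝ) => g p.2 :=
    hg.comp measurable_snd
  obtain ⟨Γ, hΓ₁, hΓ₂⟩ := exists_glue γ η hg₂ (by
    rw [hη₁, ← hγ₂, Measure.map_map hg measurable_snd]; rfl)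
  have hΓm : Measurable (Prod.map (fun p : (Fin dIn → ℝ) × (Fin dIn → ℝ) => g p.2)
      (id : (Fin dOut → ℝ) → _)) := hg₂.prodMap measurable_id
  have hΓ₃ : Γ.map Prod.snd = νl := by
    rw [← hη₂, ← hΓ₂, Measure.map_map measurable_snd hΓm]
    rfl
  set r : (Fin dIn → ℝ) → Fin dOut → ℝ := fun x i => max 0 (g x i) with hr_def
  have hr : Measurable r := by
    refine measurable_pi_lambda _ fun i => ?_
    exact measurable_const.max ((measurable_pi_apply i).comp hg)
  have hrm : Measurable fun q : ((Fin dIn → ℝ) × (Fin dIn → ℝ)) × (Fin dOut → ℝ) =>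
      (r q.1.1, q.2) := by fun_prop
  have hγint := integrable_l1dist_of_map hγ₁ hγ₂ (integrable_coord hY) (integrable_coord hXt)
  have hηint := integrable_l1dist_of_map hη₁ hη₂ hgX hν
  have hd : ∀ n : ℕ, Measurable fun p : (Fin n → ℝ) × (Fin n → ℝ) => l1dist p.1 p.2 := by
    intro n
    unfold l1dist
    fun_prop
  have e₁ : ∫ p, l1dist p.1 p.2 ∂γ = ∫ q, l1dist q.1.1 q.1.2 ∂Γ := by
    conv_lhs => rw [← hΓ₁]
    exact integral_map measurable_fst.aemeasurable (hd _).aestronglyMeasurable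
  have e₂ : ∫ p, l1dist p.1 p.2 ∂η = ∫ q, l1dist (g q.1.2) q.2 ∂Γ := by
    conv_lhs => rw [← hΓ₂]
    exact integral_map hΓm.aemeasurable (hd _).aestronglyMeasurable
  have e₃ : ∑ i, ∫ z, max 0 (-z i) ∂νl = ∫ q, ∑ i, max 0 (-q.2 i) ∂Γ := by
    rw [← integral_finsetSum _ fun i _ => hneg i, ← hΓ₃]
    exact integral_map measurable_snd.aemeasurable
      (Finset.measurable_fun_sum _ fun i _ =>
        measurable_const.max (measurable_pi_apply i).neg).aestronglyMeasurable
  have i₁ : Integrable (fun q => l1dist q.1.1 q.1.2) Γ := by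
    rw [← hΓ₁] at hγint
    exact hγint.comp_measurable measurable_fst
  have i₂ : Integrable (fun q => l1dist (g q.1.2) q.2) Γ := by
    rw [← hΓ₂] at hηint
    exact hηint.comp_measurable hΓm
  have i₃ : Integrable (fun q => ∑ i, max 0 (-q.2 i)) Γ := by
    have h := integrable_finsetSum Finset.univ fun i _ => hneg i
    rw [← hΓ₃] at h
    exact h.comp_measurable measurable_snd
  have hcoup : W1 l1dist (ρY.map r) νl ≤ ∫ q, l1dist (r q.1.1) q.2 ∂Γ := by
    refine (W1_le_integral l1dist_nonneg (γ := Γ.map fun q => (r q.1.1, q.2)) ?_ ?_).trans_eq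
      (integral_map hrm.aemeasurable (hd _).aestronglyMeasurable)
    · rw [← hγ₁, ← hΓ₁, Measure.map_map measurable_fst hrm,
        Measure.map_map measurable_fst measurable_fst,
        Measure.map_map hr (measurable_fst.comp measurable_fst)]
      rfl
    · rw [← hΓ₃, Measure.map_map measurable_snd hrm]
      rfl
  have i₃₂ : Integrable (fun q => ∑ i, max 0 (-q.2 i) + l1dist (g q.1.2) q.2) Γ := i₃.add i₂
  refine hcoup.trans ?_
  simp_rw [← hgap]
  rw [e₃, e₂, e₁, ← integral_const_mul, ← integral_add i₃ i₂,
    ← integral_add i₃₂ (i₁.const_mul _)]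
  refine integral_mono_of_nonneg (.of_forall fun q => l1dist_nonneg _ _)
    (i₃₂.add (i₁.const_mul _)) (.of_forall fun q => ?_)
  have hA := l1dist_affine_le Aᵀ b q.1.1 q.1.2
  have hsum : l1dist (r q.1.1) q.2 ≤ ∑ i, max 0 (-q.2 i) + l1dist (g q.1.1) (g q.1.2)
      + l1dist (g q.1.2) q.2 := by
    simp only [l1dist, ← Finset.sum_add_distrib]
    exact Finset.sum_le_sum fun i _ => abs_relu_sub_le _ _ _
  change l1dist (r q.1.1) q.2 ≤ ∑ i, max 0 (-q.2 i) + l1dist (g q.1.2) q.2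
    + l1OpNorm Aᵀ * l1dist q.1.1 q.1.2
  linarith
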